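/- arXiv:2311.00852 — 3 statements merged into one kernel-verified Lean document; each statement's English description precedes it below -/
import Mathlib

section
/- Let N ≥ 1, 0 < s < 1, 1 < p < ∞, θ = θ₁ + θ₂ with 0 < sp + θ < N, 0 < μ < N, and δ ≥ 0 with 2δ + μ ≤ N. Then there exists a constant C = C(N,δ,θ,μ) > 0 such that for every measurable function u : ℝ^N → ℝ one has ∫_{ℝ^N}∫_{ℝ^N} |u(x)|^{p♯_s(δ,θ,μ)} |u(y)|^{p♯_s(δ,θ,μ)} / (|x|^δ |x−y|^μ |y|^δ) dx dy ≤ C · ( ∫_{ℝ^N} |u(x)|^{p*_s(0,θ)} dx )^{2(N−δ−μ/2)/N}. -/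
open MeasureTheory ENNReal Filter Topology

noncomputable section

/-- Weighted Gagliardo energy `[u]^p`, as an extended nonnegative real. -/
def gaglE (N : ℕ) (s p θ₁ θ₂ : ℝ) (u : EuclideanSpace ℝ (Fin N) → ℝ) : ℝ≥0∞ :=
  ∫⁻ x, ∫⁻ y, ENNReal.ofReal
    (|u x - u y| ^ p / (‖x‖ ^ θ₁ * ‖x - y‖ ^ ((N : ℝ) + s * p) * ‖y‖ ^ θ₂))

/-- Weighted Hardy energy `∫ |u|^p |x|^{-sp-θ}`, as an extended nonnegative real. -/
def hardyE (N : ℕ) (s p θ : ℝ) (u : EuclideanSpace ℝ (Fin N) → ℝ) : ℝ≥0∞ :=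
  ∫⁻ x, ENNReal.ofReal (|u x| ^ p * ‖x‖ ^ (-(s * p + θ)))

/-- The best fractional Hardy constant `γ_H`. -/
def gammaH (N : ℕ) (s p θ₁ θ₂ : ℝ) : ℝ :=
  sInf { r : ℝ | ∃ u : EuclideanSpace ℝ (Fin N) → ℝ, Measurable u ∧
    ¬ (∀ᵐ x : EuclideanSpace ℝ (Fin N), u x = 0) ∧
    gaglE N s p θ₁ θ₂ u < ⊤ ∧
    0 < hardyE N s p (θ₁ + θ₂) u ∧ hardyE N s p (θ₁ + θ₂) u < ⊤ ∧
    r = (gaglE N s p θ₁ θ₂ u).toReal / (hardyE N s p (θ₁ + θ₂) u).toReal }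

/-- Hardy–Sobolev critical exponent `p*_s(β,θ)`. -/
def pStar (N : ℕ) (s p θ β : ℝ) : ℝ := p * ((N : ℝ) - β) / ((N : ℝ) - s * p - θ)

/-- Stein–Weiss upper critical exponent `p♯_s(δ,θ,μ)`. -/
def pSharp (N : ℕ) (s p θ δ μ : ℝ) : ℝ :=
  p * ((N : ℝ) - δ - μ / 2) / ((N : ℝ) - s * p - θ)

/-- The quadratic Choquard (Stein–Weiss) energy `Q♯(u,u)`. -/
def Qsharp (N : ℕ) (s p θ δ μ : ℝ) (u : EuclideanSpace ℝ (Fin N) → ℝ) : ℝ :=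
  ∫ x, ∫ y, |u x| ^ (pSharp N s p θ δ μ) * |u y| ^ (pSharp N s p θ δ μ) /
    (‖x‖ ^ δ * ‖x - y‖ ^ μ * ‖y‖ ^ δ)

/-- The weighted Morrey norm `‖u‖_{L_M^{q,κ}(ℝ^N, |y|^{-lam})}`. -/
def morreyNorm (N : ℕ) (q κ lam : ℝ) (u : EuclideanSpace ℝ (Fin N) → ℝ) : ℝ :=
  sSup { m : ℝ | ∃ (x : EuclideanSpace ℝ (Fin N)) (R : ℝ), 0 < R ∧
    m = (R ^ (κ - (N : ℝ)) * ∫ y in Metric.ball x R, |u y| ^ q * ‖y‖ ^ (-lam)) ^ (1 / q) }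

lemma setLIntegral_dist_rpow_le_of_geometric_cover
    {X : Type*} [PseudoMetricSpace X] [MeasurableSpace X] [OpensMeasurableSpace X]
    {ν : Measure X} {A d a q R : ℝ} (hA : 0 ≤ A) {x : X}
    (hν : ∀ r : ℝ, 0 < r → ν (Metric.ball x r) ≤ ENNReal.ofReal (A * r ^ d))
    (hq : 0 < q) (hqd : q ^ (d - a) < 1) (hR : 0 < R) {s : Set X} (hs : MeasurableSet s)
    (hcov : ∀ y ∈ s, ∃ k : ℕ, dist x y < 2 * (R * q ^ k) ∧
      dist x y ^ (-a) ≤ (R * q ^ k / 2) ^ (-a)) :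
    ∫⁻ y in s, ENNReal.ofReal (dist x y ^ (-a)) ∂ν ≤
      ENNReal.ofReal (A * 2 ^ (d + a) * (1 - q ^ (d - a))⁻¹ * R ^ (d - a)) := by
  have hρ : ∀ k : ℕ, 0 < R * q ^ k := fun k => by positivity
  calc ∫⁻ y in s, ENNReal.ofReal (dist x y ^ (-a)) ∂ν
      ≤ ∫⁻ y in s, ∑' k : ℕ, (Metric.ball x (2 * (R * q ^ k))).indicator
          (fun _ => ENNReal.ofReal ((R * q ^ k / 2) ^ (-a))) y ∂ν := by
        refine setLIntegral_mono' hs fun y hy => ?_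
        obtain ⟨k, hk1, hk2⟩ := hcov y hy
        refine le_trans ?_ (ENNReal.le_tsum k)
        rw [Set.indicator_of_mem (by rwa [Metric.mem_ball'])]
        exact ENNReal.ofReal_le_ofReal hk2
    _ ≤ ∫⁻ y, ∑' k : ℕ, (Metric.ball x (2 * (R * q ^ k))).indicator
          (fun _ => ENNReal.ofReal ((R * q ^ k / 2) ^ (-a))) y ∂ν :=
        setLIntegral_le_lintegral _ _
    _ = ∑' k : ℕ, ENNReal.ofReal ((R * q ^ k / 2) ^ (-a)) *
          ν (Metric.ball x (2 * (R * q ^ k))) := by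
        rw [lintegral_tsum fun k =>
          (measurable_const.indicator Metric.isOpen_ball.measurableSet).aemeasurable]
        simp_rw [lintegral_indicator_const Metric.isOpen_ball.measurableSet]
    _ ≤ ∑' k : ℕ, ENNReal.ofReal (A * 2 ^ (d + a) * R ^ (d - a) * (q ^ (d - a)) ^ k) := by
        refine ENNReal.tsum_le_tsum fun k => ?_
        refine (mul_le_mul_right (hν _ (by have := hρ k; positivity)) _).trans_eq ?_
        rw [← ENNReal.ofReal_mul (by have := hρ k; positivity)]
        congr 1
        have h1 : (q ^ (d - a)) ^ k = (q ^ k) ^ (d - a) := by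
          rw [← Real.rpow_natCast, ← Real.rpow_natCast, ← Real.rpow_mul hq.le,
            ← Real.rpow_mul hq.le, mul_comm]
        rw [h1, mul_assoc (A * 2 ^ (d + a)), ← Real.mul_rpow hR.le (by positivity),
          Real.div_rpow (hρ k).le (by norm_num), Real.mul_rpow (by norm_num) (hρ k).le,
          Real.rpow_neg (by norm_num : (0 : ℝ) ≤ 2), Real.rpow_add (by norm_num : (0 : ℝ) < 2),
          sub_eq_add_neg, Real.rpow_add (hρ k)]
        field_simp
    _ = _ := by
        rw [← ENNReal.ofReal_tsum_of_nonneg (fun k => by positivity)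
          ((summable_geometric_of_lt_one (by positivity) hqd).mul_left _), tsum_mul_left,
          tsum_geometric_of_lt_one (by positivity) hqd]
        congr 1
        ring

lemma setLIntegral_ball_dist_rpow_le
    {X : Type*} [PseudoMetricSpace X] [MeasurableSpace X] [OpensMeasurableSpace X]
    {ν : Measure X} {A d a : ℝ} (hA : 0 < A)
    (hν : ∀ (x : X) (r : ℝ), 0 < r → ν (Metric.ball x r) ≤ ENNReal.ofReal (A * r ^ d))
    (ha : 0 ≤ a) (had : a < d) :
    ∃ C : ℝ, 0 < C ∧ ∀ (x : X) (R : ℝ), 0 < R →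
      ∫⁻ y in Metric.ball x R, ENNReal.ofReal (dist x y ^ (-a)) ∂ν ≤
        ENNReal.ofReal (C * R ^ (d - a)) := by
  have hq : (1 / 2 : ℝ) ^ (d - a) < 1 :=
    Real.rpow_lt_one (by norm_num) (by norm_num) (by linarith)
  refine ⟨A * 2 ^ (d + a) * (1 - (1 / 2 : ℝ) ^ (d - a))⁻¹,
    mul_pos (by positivity) (inv_pos.2 (by linarith)), fun x R hR => ?_⟩
  refine setLIntegral_dist_rpow_le_of_geometric_cover hA.le (hν x) (by norm_num) hq hR
    Metric.isOpen_ball.measurableSet fun y hy => ?_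
  rw [Metric.mem_ball'] at hy
  rcases (dist_nonneg (x := x) (y := y)).eq_or_lt with h0 | h0
  · refine ⟨0, by rw [← h0]; positivity, ?_⟩
    rw [← h0]
    rcases ha.eq_or_lt with rfl | ha
    · simp
    · rw [Real.zero_rpow (by linarith)]
      positivity
  · obtain ⟨k, hk1, hk2⟩ := exists_nat_pow_near_of_lt_one (div_pos h0 hR)
      ((div_le_one hR).2 hy.le) (by norm_num : (0 : ℝ) < 1 / 2) (by norm_num)
    rw [lt_div_iff₀ hR, pow_succ] at hk1
    rw [div_le_iff₀ hR] at hk2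
    refine ⟨k, by linarith, Real.rpow_le_rpow_of_nonpos (by positivity) ?_ (by linarith)⟩
    linarith

lemma setLIntegral_compl_ball_dist_rpow_le
    {X : Type*} [PseudoMetricSpace X] [MeasurableSpace X] [OpensMeasurableSpace X]
    {ν : Measure X} {A d a : ℝ} (hA : 0 < A)
    (hν : ∀ (x : X) (r : ℝ), 0 < r → ν (Metric.ball x r) ≤ ENNReal.ofReal (A * r ^ d))
    (ha : 0 ≤ a) (had : d < a) :
    ∃ C : ℝ, 0 < C ∧ ∀ (x : X) (R : ℝ), 0 < R →
      ∫⁻ y in (Metric.ball x R)ᶜ, ENNReal.ofReal (dist x y ^ (-a)) ∂ν ≤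
        ENNReal.ofReal (C * R ^ (d - a)) := by
  have hq : (2 : ℝ) ^ (d - a) < 1 :=
    Real.rpow_lt_one_of_one_lt_of_neg (by norm_num) (by linarith)
  refine ⟨A * 2 ^ (d + a) * (1 - (2 : ℝ) ^ (d - a))⁻¹,
    mul_pos (by positivity) (inv_pos.2 (by linarith)), fun x R hR => ?_⟩
  refine setLIntegral_dist_rpow_le_of_geometric_cover hA.le (hν x) (by norm_num) hq hR
    Metric.isOpen_ball.measurableSet.compl fun y hy => ?_
  rw [Set.mem_compl_iff, Metric.mem_ball', not_lt] at hy
  obtain ⟨k, hk1, hk2⟩ := exists_nat_pow_near ((one_le_div hR).2 hy) (by norm_num : (1 : ℝ) < 2)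
  rw [le_div_iff₀ hR] at hk1
  rw [div_lt_iff₀ hR, pow_succ] at hk2
  have : 0 < R * 2 ^ k := by positivity
  exact ⟨k, by linarith, Real.rpow_le_rpow_of_nonpos (by positivity) (by linarith) (by linarith)⟩

lemma lintegral_lintegral_le_two_mul_of_le_add_swap
    {X : Type*} [MeasurableSpace X] {m : Measure X} [SFinite m]
    {G H : X → X → ℝ≥0∞} (hH : Measurable (Function.uncurry H))
    (hGH : ∀ x y, G x y ≤ H x y + H y x) :
    ∫⁻ x, ∫⁻ y, G x y ∂m ∂m ≤ 2 * ∫⁻ x, ∫⁻ y, H x y ∂m ∂m := by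
  calc ∫⁻ x, ∫⁻ y, G x y ∂m ∂m ≤ ∫⁻ x, ∫⁻ y, (H x y + H y x) ∂m ∂m :=
        lintegral_mono fun x => lintegral_mono fun y => hGH x y
    _ = ∫⁻ x, (∫⁻ y, H x y ∂m) + ∫⁻ y, H y x ∂m ∂m :=
        lintegral_congr fun x => lintegral_add_left hH.of_uncurry_left _
    _ = ∫⁻ x, ∫⁻ y, H x y ∂m ∂m + ∫⁻ x, ∫⁻ y, H y x ∂m ∂m :=
        lintegral_add_left hH.lintegral_prod_right' _
    _ = _ := by
        rw [lintegral_lintegral_swap (f := fun x y => H y x)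
          (hH.comp measurable_swap).aemeasurable, two_mul]

/-- Riesz potential of the part of `g` below level `l`, split at the optimal radius. -/
lemma lintegral_truncated_riesz_le
    {X : Type*} [PseudoMetricSpace X] [MeasurableSpace X] [OpensMeasurableSpace X]
    {ν : Measure X} {A d μ t : ℝ} (hA : 0 < A)
    (hν : ∀ (x : X) (r : ℝ), 0 < r → ν (Metric.ball x r) ≤ ENNReal.ofReal (A * r ^ d))
    (hμ : 0 < μ) (hμd : μ < d) (ht : t = 2 * d / (2 * d - μ)) :
    ∃ C : ℝ, 0 < C ∧ ∀ (g : X → ℝ), Measurable g → (∀ x, 0 ≤ g x) → ∀ M : ℝ, 0 < M →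
      ∫⁻ y, ENNReal.ofReal (g y) ^ t ∂ν ≤ ENNReal.ofReal (M ^ t) → ∀ (x : X) (l : ℝ), 0 < l →
      ∫⁻ y, (if g y ≤ l then ENNReal.ofReal (g y) * ENNReal.ofReal (dist x y ^ (-μ)) else 0) ∂ν ≤
        ENNReal.ofReal (C * M ^ (2 - t) * l ^ (t - 1)) := by
  obtain ⟨C₁, hC₁, h₁⟩ := setLIntegral_ball_dist_rpow_le hA hν hμ.le hμd
  obtain ⟨C₂, hC₂, h₂⟩ := setLIntegral_compl_ball_dist_rpow_le (a := 2 * d) hA hν (by linarith) (by linarith)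
  have hd : 0 < d := hμ.trans hμd
  have hD : 0 < 2 * d - μ := by linarith
  have ht1 : 1 < t := by rw [ht, lt_div_iff₀ hD]; linarith
  have hconj : t.HolderConjugate (2 * d / μ) := by
    rw [Real.holderConjugate_iff]
    refine ⟨ht1, ?_⟩
    rw [ht]; field_simp; ring
  refine ⟨C₁ + C₂ ^ (μ / (2 * d)), by positivity, fun g hg hg0 M hM hgM x l hl => ?_⟩
  set R : ℝ := (M / l) ^ (t / d) with hR
  have hR0 : 0 < R := by positivity
  have hml : 0 < M / l := by positivity
  have hB : MeasurableSet (Metric.ball x R) := Metric.isOpen_ball.measurableSet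
  have hk : Measurable fun y => ENNReal.ofReal (dist x y ^ (-μ)) :=
    ((continuous_const.dist continuous_id).measurable.pow_const _).ennreal_ofReal
  rw [← lintegral_add_compl _ hB]
  have e1 : l * (C₁ * R ^ (d - μ)) = C₁ * M ^ (2 - t) * l ^ (t - 1) := by
    rw [hR, ← Real.rpow_mul hml.le, show t / d * (d - μ) = 2 - t by rw [ht]; field_simp; ring,
      Real.div_rpow hM.le hl.le, show t - 1 = 1 - (2 - t) by ring, Real.rpow_sub hl 1, Real.rpow_one]
    ring
  have e2 : M * (C₂ * R ^ (d - 2 * d)) ^ (μ / (2 * d)) =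
      C₂ ^ (μ / (2 * d)) * M ^ (2 - t) * l ^ (t - 1) := by
    rw [hR, ← Real.rpow_mul hml.le, Real.mul_rpow hC₂.le (by positivity), ← Real.rpow_mul hml.le,
      show t / d * (d - 2 * d) * (μ / (2 * d)) = 1 - t by rw [ht]; field_simp; ring,
      Real.div_rpow hM.le hl.le, show 2 - t = 1 + (1 - t) by ring,
      Real.rpow_add hM, Real.rpow_one, show t - 1 = - (1 - t) by ring, Real.rpow_neg hl.le]
    field_simp
  have near_le : ∫⁻ y in Metric.ball x R,
      (if g y ≤ l then ENNReal.ofReal (g y) * ENNReal.ofReal (dist x y ^ (-μ)) else 0) ∂ν ≤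
        ENNReal.ofReal (C₁ * M ^ (2 - t) * l ^ (t - 1)) := by
    calc _ ≤ ∫⁻ y in Metric.ball x R,
          ENNReal.ofReal l * ENNReal.ofReal (dist x y ^ (-μ)) ∂ν := by
          refine lintegral_mono fun y => ?_
          split_ifs with h
          · gcongr
          · exact zero_le
      _ ≤ ENNReal.ofReal l * ENNReal.ofReal (C₁ * R ^ (d - μ)) := by
          rw [lintegral_const_mul _ hk]
          gcongr
          exact h₁ x R hR0
      _ = _ := by rw [← ENNReal.ofReal_mul hl.le, e1]
  have far_le : ∫⁻ y in (Metric.ball x R)ᶜ,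
      (if g y ≤ l then ENNReal.ofReal (g y) * ENNReal.ofReal (dist x y ^ (-μ)) else 0) ∂ν ≤
        ENNReal.ofReal (C₂ ^ (μ / (2 * d)) * M ^ (2 - t) * l ^ (t - 1)) := by
    calc _ ≤ ∫⁻ y in (Metric.ball x R)ᶜ,
          ((fun y => ENNReal.ofReal (g y)) * fun y => ENNReal.ofReal (dist x y ^ (-μ))) y ∂ν := by
          refine lintegral_mono fun y => ?_
          dsimp only [Pi.mul_apply]
          split_ifs with h
          · exact le_rfl
          · exact zero_le
      _ ≤ _ := ENNReal.lintegral_mul_le_Lp_mul_Lq _ hconj hg.ennreal_ofReal.aemeasurable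
          hk.aemeasurable
      _ ≤ ENNReal.ofReal (M ^ t) ^ (1 / t) *
          ENNReal.ofReal (C₂ * R ^ (d - 2 * d)) ^ (1 / (2 * d / μ)) := by
          gcongr
          · exact (setLIntegral_le_lintegral _ _).trans hgM
          · refine le_trans (lintegral_mono fun y => ?_) (h₂ x R hR0)
            rw [ENNReal.ofReal_rpow_of_nonneg (by positivity) (by positivity),
              ← Real.rpow_mul dist_nonneg, show -μ * (2 * d / μ) = -(2 * d) by field_simp]
      _ = _ := by
          rw [ENNReal.ofReal_rpow_of_nonneg (by positivity) (by positivity),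
            ENNReal.ofReal_rpow_of_nonneg (by positivity) (by positivity),
            ← Real.rpow_mul hM.le, mul_one_div_cancel (by positivity), Real.rpow_one,
            ← ENNReal.ofReal_mul hM.le, one_div_div, e2]
  refine (add_le_add near_le far_le).trans_eq ?_
  rw [← ENNReal.ofReal_add (by positivity) (by positivity)]
  ring_nf

/-- Hardy–Littlewood–Sobolev inequality on the diagonal, for an upper `d`-regular measure. -/
lemma hardy_littlewood_sobolev_of_measure_ball_le
    {X : Type*} [PseudoMetricSpace X] [SecondCountableTopology X] [MeasurableSpace X]
    [OpensMeasurableSpace X]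
    {ν : Measure X} [SFinite ν] {A d μ t : ℝ} (hA : 0 < A)
    (hν : ∀ (x : X) (r : ℝ), 0 < r → ν (Metric.ball x r) ≤ ENNReal.ofReal (A * r ^ d))
    (hμ : 0 < μ) (hμd : μ < d) (ht : t = 2 * d / (2 * d - μ)) :
    ∃ C : ℝ, 0 < C ∧ ∀ (g : X → ℝ), Measurable g → (∀ x, 0 ≤ g x) →
      ∫⁻ x, ∫⁻ y, ENNReal.ofReal (g x) * ENNReal.ofReal (g y) *
        ENNReal.ofReal (dist x y ^ (-μ)) ∂ν ∂ν ≤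
        ENNReal.ofReal C * (∫⁻ x, ENNReal.ofReal (g x) ^ t ∂ν) ^ (2 / t) := by
  obtain ⟨C, hC, h⟩ := lintegral_truncated_riesz_le hA hν hμ hμd ht
  have hd : 0 < d := hμ.trans hμd
  have hD : 0 < 2 * d - μ := by linarith
  have ht1 : 1 < t := by rw [ht, lt_div_iff₀ hD]; linarith
  refine ⟨2 * C, by positivity, fun g hg hg0 => ?_⟩
  have hF : Measurable fun x => ENNReal.ofReal (g x) := hg.ennreal_ofReal
  set S := ∫⁻ x, ENNReal.ofReal (g x) ^ t ∂ν with hS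
  by_cases hSt : S = ⊤
  · rw [hSt, ENNReal.top_rpow_of_pos (by positivity), ENNReal.mul_top]
    · exact le_top
    · simpa using hC
  by_cases hS0 : S = 0
  · rw [hS, lintegral_eq_zero_iff (hF.pow_const _)] at hS0
    refine le_trans (le_of_eq ?_) zero_le
    rw [← lintegral_zero (μ := ν)]
    refine lintegral_congr_ae (hS0.mono fun x hx => ?_)
    have : ENNReal.ofReal (g x) = 0 := by
      simpa [ENNReal.rpow_eq_zero_iff_of_pos (zero_lt_one.trans ht1)] using hx
    simp [this]
  have hSr : 0 < S.toReal := ENNReal.toReal_pos hS0 hSt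
  set M : ℝ := S.toReal ^ (1 / t) with hM
  have hM0 : 0 < M := by positivity
  have hMt : M ^ t = S.toReal := by
    rw [hM, ← Real.rpow_mul hSr.le, one_div_mul_cancel (by positivity), Real.rpow_one]
  have hMS : ENNReal.ofReal (M ^ t) = S := by rw [hMt, ENNReal.ofReal_toReal hSt]
  refine (lintegral_lintegral_le_two_mul_of_le_add_swap (H := fun x y => ENNReal.ofReal (g x) * if g y ≤ g x then
    ENNReal.ofReal (g y) * ENNReal.ofReal (dist x y ^ (-μ)) else 0) ?_ fun x y => ?_).trans ?_
  · refine (hF.comp measurable_fst).mul (Measurable.ite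
      (measurableSet_le (hg.comp measurable_snd) (hg.comp measurable_fst)) ?_ measurable_const)
    exact (hF.comp measurable_snd).mul
      ((measurable_dist.pow_const _).ennreal_ofReal)
  · rcases le_total (g y) (g x) with hxy | hxy
    · refine le_trans (le_of_eq ?_) le_self_add
      rw [if_pos hxy, mul_assoc]
    · refine le_trans (le_of_eq ?_) le_add_self
      rw [if_pos hxy, dist_comm]
      ring
  · have key : ∀ x, ∫⁻ y, (ENNReal.ofReal (g x) * if g y ≤ g x then
        ENNReal.ofReal (g y) * ENNReal.ofReal (dist x y ^ (-μ)) else 0) ∂ν ≤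
        ENNReal.ofReal (C * M ^ (2 - t)) * ENNReal.ofReal (g x) ^ t := by
      intro x
      rw [lintegral_const_mul' _ _ ENNReal.ofReal_ne_top]
      rcases (hg0 x).eq_or_lt with h0 | h0
      · simp [← h0]
      refine (mul_le_mul_right (h g hg hg0 M hM0 hMS.ge x (g x) h0) _).trans_eq ?_
      rw [ENNReal.ofReal_rpow_of_pos h0, ← ENNReal.ofReal_mul h0.le,
        ← ENNReal.ofReal_mul (by positivity), Real.rpow_sub h0, Real.rpow_one]
      congr 1
      field_simp
    refine (mul_le_mul_right (lintegral_mono key) _).trans_eq ?_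
    rw [lintegral_const_mul' _ _ ENNReal.ofReal_ne_top, ← hS]
    conv_lhs => rw [← hMS]
    conv_rhs => rw [← hMS]
    rw [ENNReal.ofReal_rpow_of_pos (by positivity), ← Real.rpow_mul hM0.le,
      mul_div_cancel₀ _ (by positivity), ← ENNReal.ofReal_mul (by positivity),
      ← ENNReal.ofReal_mul (by positivity),
      show (2 : ℝ≥0∞) = ENNReal.ofReal 2 by simp, ← ENNReal.ofReal_mul (by norm_num),
      mul_assoc C, ← Real.rpow_add hM0, sub_add_cancel, mul_assoc 2 C]

lemma addHaar_ball_le_rpow {E : Type*} [NormedAddCommGroup E] [NormedSpace ℝ E] [MeasurableSpace E]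
    [BorelSpace E] [FiniteDimensional ℝ E] [Nontrivial E] (m : Measure E) [m.IsAddHaarMeasure] :
    ∃ A : ℝ, 0 < A ∧ ∀ (x : E) (r : ℝ), 0 < r →
      m (Metric.ball x r) ≤ ENNReal.ofReal (A * r ^ (Module.finrank ℝ E : ℝ)) := by
  have h0 : m (Metric.ball (0 : E) 1) ≠ 0 := (Metric.measure_ball_pos m 0 one_pos).ne'
  have ht : m (Metric.ball (0 : E) 1) ≠ ⊤ := measure_ball_lt_top.ne
  refine ⟨(m (Metric.ball (0 : E) 1)).toReal, ENNReal.toReal_pos h0 ht, fun x r hr => ?_⟩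
  rw [Measure.addHaar_ball m x hr.le, ENNReal.ofReal_mul ENNReal.toReal_nonneg,
    ENNReal.ofReal_toReal ht, Real.rpow_natCast, mul_comm]

lemma withDensity_norm_rpow_ball_le {E : Type*} [NormedAddCommGroup E] [MeasurableSpace E]
    [OpensMeasurableSpace E] {m : Measure E} {A d α : ℝ} (hA : 0 < A)
    (hm : ∀ (x : E) (r : ℝ), 0 < r → m (Metric.ball x r) ≤ ENNReal.ofReal (A * r ^ d))
    (hα : 0 ≤ α) (hαd : α < d) :
    ∃ B : ℝ, 0 < B ∧ ∀ (x : E) (r : ℝ), 0 < r →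
      m.withDensity (fun y => ENNReal.ofReal (‖y‖ ^ (-α))) (Metric.ball x r) ≤
        ENNReal.ofReal (B * r ^ (d - α)) := by
  obtain ⟨C, hC, h⟩ := setLIntegral_ball_dist_rpow_le hA hm hα hαd
  refine ⟨C + A, by positivity, fun x r hr => ?_⟩
  rw [withDensity_apply _ Metric.isOpen_ball.measurableSet,
    ← lintegral_inter_add_sdiff _ _ (Metric.isOpen_ball (x := (0 : E)) (ε := r)).measurableSet,
    add_mul, ENNReal.ofReal_add (by positivity) (by positivity)]
  refine add_le_add ?_ ?_
  · refine (lintegral_mono_set Set.inter_subset_right).trans ?_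
    simpa using h 0 r hr
  · calc ∫⁻ y in Metric.ball x r \ Metric.ball 0 r, ENNReal.ofReal (‖y‖ ^ (-α)) ∂m
        ≤ ∫⁻ y in Metric.ball x r \ Metric.ball 0 r, ENNReal.ofReal (r ^ (-α)) ∂m := by
          refine setLIntegral_mono' (Metric.isOpen_ball.measurableSet.diff
            Metric.isOpen_ball.measurableSet) fun y hy => ENNReal.ofReal_le_ofReal ?_
          exact Real.rpow_le_rpow_of_nonpos hr (by simpa using hy.2) (by linarith)
      _ ≤ ENNReal.ofReal (r ^ (-α)) * ENNReal.ofReal (A * r ^ d) := by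
          rw [setLIntegral_const]
          gcongr
          exact (measure_mono Set.sdiff_subset).trans (hm x r hr)
      _ = _ := by
          rw [← ENNReal.ofReal_mul (by positivity), sub_eq_neg_add, Real.rpow_add hr]
          ring_nf

/-- The Schur test integral for the Stein–Weiss kernel. -/
lemma lintegral_norm_rpow_mul_dist_rpow_le {E : Type*} [NormedAddCommGroup E] [MeasurableSpace E]
    [OpensMeasurableSpace E] {m : Measure E} {A d μ β : ℝ} (hA : 0 < A)
    (hm : ∀ (x : E) (r : ℝ), 0 < r → m (Metric.ball x r) ≤ ENNReal.ofReal (A * r ^ d))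
    (hμ : 0 ≤ μ) (hμd : μ < d) (hβ : 0 ≤ β) (hβd : β < d) (hβμ : d < β + μ) :
    ∃ C : ℝ, 0 < C ∧ ∀ x : E, x ≠ 0 →
      ∫⁻ y, ENNReal.ofReal (‖y‖ ^ (-β) * dist x y ^ (-μ)) ∂m ≤
        ENNReal.ofReal (C * ‖x‖ ^ (d - β - μ)) := by
  obtain ⟨C₁, hC₁, h₁⟩ := setLIntegral_ball_dist_rpow_le hA hm hμ hμd
  obtain ⟨C₂, hC₂, h₂⟩ := setLIntegral_ball_dist_rpow_le hA hm hβ hβd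
  obtain ⟨C₃, hC₃, h₃⟩ := setLIntegral_compl_ball_dist_rpow_le hA hm (add_nonneg hβ hμ) hβμ
  refine ⟨C₁ * (1 / 2) ^ (d - μ - β) + C₂ * (1 / 2) ^ (d - β - μ) +
    3 ^ μ * C₃ * (1 / 2) ^ (d - (β + μ)), by positivity, fun x hx => ?_⟩
  have hx0 : 0 < ‖x‖ := norm_pos_iff.2 hx
  set r : ℝ := ‖x‖ * (1 / 2) with hr
  have hr0 : 0 < r := by positivity
  have tri : ∀ y, ‖x‖ ≤ dist x y + ‖y‖ := fun y => by
    rw [dist_eq_norm]; simpa using norm_add_le (x - y) y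
  have tri' : ∀ y, ‖y‖ ≤ ‖x‖ + dist x y := fun y => by
    rw [dist_comm, dist_eq_norm, add_comm]; simpa using norm_add_le (y - x) x
  set k : E → ℝ≥0∞ := fun y => ENNReal.ofReal (‖y‖ ^ (-β) * dist x y ^ (-μ)) with hkd
  have hcover : (Set.univ : Set E) ⊆
      Metric.ball x r ∪ Metric.ball 0 r ∪ ((Metric.ball 0 r)ᶜ ∩ (Metric.ball x r)ᶜ) := by
    intro y _
    by_cases h1 : y ∈ Metric.ball x r <;> by_cases h2 : y ∈ Metric.ball 0 r <;> simp_all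
  have I1 : ∫⁻ y in Metric.ball x r, k y ∂m ≤
      ENNReal.ofReal (C₁ * (1 / 2) ^ (d - μ - β) * ‖x‖ ^ (d - β - μ)) := by
    calc _ ≤ ∫⁻ y in Metric.ball x r,
          ENNReal.ofReal (r ^ (-β)) * ENNReal.ofReal (dist x y ^ (-μ)) ∂m := by
          refine setLIntegral_mono' Metric.isOpen_ball.measurableSet fun y hy => ?_
          rw [Metric.mem_ball'] at hy
          rw [← ENNReal.ofReal_mul (by positivity)]
          refine ENNReal.ofReal_le_ofReal (mul_le_mul_of_nonneg_right ?_ (by positivity))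
          exact Real.rpow_le_rpow_of_nonpos hr0 (by linarith [tri y]) (by linarith)
      _ ≤ ENNReal.ofReal (r ^ (-β)) * ENNReal.ofReal (C₁ * r ^ (d - μ)) := by
          rw [lintegral_const_mul' _ _ ENNReal.ofReal_ne_top]
          gcongr
          exact h₁ x r hr0
      _ = _ := by
          rw [← ENNReal.ofReal_mul (by positivity), mul_left_comm, ← Real.rpow_add hr0,
            hr, Real.mul_rpow hx0.le (by norm_num)]
          ring_nf
  have I2 : ∫⁻ y in Metric.ball 0 r, k y ∂m ≤
      ENNReal.ofReal (C₂ * (1 / 2) ^ (d - β - μ) * ‖x‖ ^ (d - β - μ)) := by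
    calc _ ≤ ∫⁻ y in Metric.ball 0 r,
          ENNReal.ofReal (r ^ (-μ)) * ENNReal.ofReal (dist 0 y ^ (-β)) ∂m := by
          refine setLIntegral_mono' Metric.isOpen_ball.measurableSet fun y hy => ?_
          rw [mem_ball_zero_iff] at hy
          rw [← ENNReal.ofReal_mul (by positivity), mul_comm, dist_zero_left]
          refine ENNReal.ofReal_le_ofReal (mul_le_mul_of_nonneg_left ?_ (by positivity))
          exact Real.rpow_le_rpow_of_nonpos hr0 (by linarith [tri y]) (by linarith)
      _ ≤ ENNReal.ofReal (r ^ (-μ)) * ENNReal.ofReal (C₂ * r ^ (d - β)) := by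
          rw [lintegral_const_mul' _ _ ENNReal.ofReal_ne_top]
          gcongr
          exact h₂ 0 r hr0
      _ = _ := by
          rw [← ENNReal.ofReal_mul (by positivity), mul_left_comm, ← Real.rpow_add hr0,
            hr, Real.mul_rpow hx0.le (by norm_num)]
          ring_nf
  have I3 : ∫⁻ y in (Metric.ball 0 r)ᶜ ∩ (Metric.ball x r)ᶜ, k y ∂m ≤
      ENNReal.ofReal (3 ^ μ * C₃ * (1 / 2) ^ (d - (β + μ)) * ‖x‖ ^ (d - β - μ)) := by
    calc _ ≤ ∫⁻ y in (Metric.ball 0 r)ᶜ ∩ (Metric.ball x r)ᶜ,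
          ENNReal.ofReal (3 ^ μ) * ENNReal.ofReal (dist 0 y ^ (-(β + μ))) ∂m := by
          refine setLIntegral_mono' (Metric.isOpen_ball.measurableSet.compl.inter
            Metric.isOpen_ball.measurableSet.compl) fun y hy => ?_
          simp only [Set.mem_inter_iff, Set.mem_compl_iff, dist_zero_left, Metric.mem_ball',
            not_lt] at hy
          have hy0 : 0 < ‖y‖ := hr0.trans_le hy.1
          rw [← ENNReal.ofReal_mul (by positivity), dist_zero_left, neg_add,
            Real.rpow_add hy0, mul_left_comm]
          refine ENNReal.ofReal_le_ofReal (mul_le_mul_of_nonneg_left ?_ (by positivity))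
          calc dist x y ^ (-μ) ≤ (‖y‖ / 3) ^ (-μ) :=
                Real.rpow_le_rpow_of_nonpos (by positivity) (by linarith [tri' y]) (by linarith)
            _ = _ := by
                rw [Real.div_rpow hy0.le (by norm_num), Real.rpow_neg (by norm_num : (0:ℝ) ≤ 3)]
                field_simp
      _ ≤ ENNReal.ofReal (3 ^ μ) * ENNReal.ofReal (C₃ * r ^ (d - (β + μ))) := by
          rw [lintegral_const_mul' _ _ ENNReal.ofReal_ne_top]
          gcongr
          exact (lintegral_mono_set Set.inter_subset_left).trans (h₃ 0 r hr0)
      _ = _ := by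
          rw [← ENNReal.ofReal_mul (by positivity), hr, Real.mul_rpow hx0.le (by norm_num)]
          ring_nf
  rw [← setLIntegral_univ, add_mul, add_mul, ENNReal.ofReal_add (by positivity) (by positivity),
    ENNReal.ofReal_add (by positivity) (by positivity)]
  exact (lintegral_mono_set hcover).trans ((lintegral_union_le _ _ _).trans
    (add_le_add ((lintegral_union_le _ _ _).trans (add_le_add I1 I2)) I3))

/-- Stein–Weiss inequality for `2δ + μ < d`, reduced to Hardy–Littlewood–Sobolev for the measure
with density `‖x‖ ^ (-2δd / (2δ + μ))`. -/
lemma stein_weiss_subcritical {E : Type*} [NormedAddCommGroup E] [SecondCountableTopology E]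
    [MeasurableSpace E] [BorelSpace E] {m : Measure E} [SFinite m] [NullSingletonClass m] {A d μ δ t : ℝ}
    (hA : 0 < A)
    (hm : ∀ (x : E) (r : ℝ), 0 < r → m (Metric.ball x r) ≤ ENNReal.ofReal (A * r ^ d))
    (hμ : 0 < μ) (hδ : 0 ≤ δ) (hδμ : 2 * δ + μ < d) (ht : t = d / (d - δ - μ / 2)) :
    ∃ C : ℝ, 0 < C ∧ ∀ f : E → ℝ, Measurable f → (∀ x, 0 ≤ f x) →
      ∫⁻ x, ∫⁻ y, ENNReal.ofReal (f x * f y / (‖x‖ ^ δ * ‖x - y‖ ^ μ * ‖y‖ ^ δ)) ∂m ∂m ≤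
        ENNReal.ofReal C * (∫⁻ x, ENNReal.ofReal (f x) ^ t ∂m) ^ (2 / t) := by
  have hδμ0 : 0 < 2 * δ + μ := by linarith
  have hD : 0 < d - δ - μ / 2 := by linarith
  have ht0 : 0 < t := by rw [ht]; exact div_pos (by linarith) hD
  set α : ℝ := 2 * δ * d / (2 * δ + μ) with hα
  have hα0 : 0 ≤ α := div_nonneg (mul_nonneg (by linarith) (by linarith)) hδμ0.le
  have hdα : d - α = d * μ / (2 * δ + μ) := by rw [hα]; field_simp; ring
  have hμα : μ < d - α := by
    rw [hdα, lt_div_iff₀ hδμ0]; nlinarith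
  have htα : t = 2 * (d - α) / (2 * (d - α) - μ) := by
    have h1 : 2 * (d * μ / (2 * δ + μ)) - μ ≠ 0 := by rw [← hdα]; linarith
    have h2 : d * 2 - (2 * δ + μ) ≠ 0 := by linarith
    have h3 : 2 * (d * μ / (2 * δ + μ)) - μ = μ * (d * 2 - (2 * δ + μ)) / (2 * δ + μ) := by
      field_simp
    have h4 : d - δ - μ / 2 = (d * 2 - (2 * δ + μ)) / 2 := by ring
    rw [ht, hdα, h3, h4]
    field_simp
  have hαt : (α - δ) * t = α := by
    have h5 : α - δ = 2 * δ * (d - δ - μ / 2) / (2 * δ + μ) := by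
      rw [hα]
      field_simp
      ring
    rw [h5, ht, hα]
    generalize d - δ - μ / 2 = D at hD
    field_simp
  obtain ⟨B, hB, hBm⟩ := withDensity_norm_rpow_ball_le hA hm hα0 (by linarith)
  obtain ⟨C, hC, h⟩ := hardy_littlewood_sobolev_of_measure_ball_le hB hBm hμ hμα htα
  refine ⟨C, hC, fun f hf hf0 => ?_⟩
  have hw : Measurable fun y : E => ENNReal.ofReal (‖y‖ ^ (-α)) :=
    (measurable_norm.pow_const _).ennreal_ofReal
  have hwt : ∀ᵐ y ∂m, ENNReal.ofReal (‖y‖ ^ (-α)) < ⊤ := ae_of_all _ fun y => ENNReal.ofReal_lt_top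
  have hne : ∀ᵐ y ∂m, y ≠ 0 := compl_mem_ae_iff.2 (measure_singleton 0)
  have h := h (fun x => f x * ‖x‖ ^ (α - δ)) (hf.mul (measurable_norm.pow_const _))
    (fun x => mul_nonneg (hf0 x) (by positivity))
  simp only [lintegral_withDensity_eq_lintegral_mul_non_measurable _ hw hwt, Pi.mul_apply] at h
  have hS : ∫⁻ x, ENNReal.ofReal (‖x‖ ^ (-α)) * ENNReal.ofReal (f x * ‖x‖ ^ (α - δ)) ^ t ∂m =
      ∫⁻ x, ENNReal.ofReal (f x) ^ t ∂m := by
    refine lintegral_congr_ae (hne.mono fun x hx => ?_)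
    have hx0 : 0 < ‖x‖ := norm_pos_iff.2 hx
    dsimp only
    rw [ENNReal.ofReal_rpow_of_nonneg (hf0 x) ht0.le, ENNReal.ofReal_rpow_of_nonneg
      (mul_nonneg (hf0 x) (by positivity)) ht0.le, ← ENNReal.ofReal_mul (by positivity),
      Real.mul_rpow (hf0 x) (by positivity), ← Real.rpow_mul hx0.le, hαt, mul_left_comm,
      ← Real.rpow_add hx0, neg_add_cancel, Real.rpow_zero, mul_one]
  rw [hS] at h
  refine le_trans (lintegral_mono_ae (hne.mono fun x hx => ?_)) h
  rw [← lintegral_const_mul' _ _ ENNReal.ofReal_ne_top]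
  refine lintegral_mono_ae (hne.mono fun y hy => le_of_eq ?_)
  have hx0 : 0 < ‖x‖ := norm_pos_iff.2 hx
  have hy0 : 0 < ‖y‖ := norm_pos_iff.2 hy
  have hfx := hf0 x
  have hfy := hf0 y
  rw [← ENNReal.ofReal_mul (by positivity), ← ENNReal.ofReal_mul (by positivity),
    ← ENNReal.ofReal_mul (by positivity), ← ENNReal.ofReal_mul (by positivity), dist_eq_norm,
    Real.rpow_neg (norm_nonneg (x - y)), Real.rpow_sub hx0, Real.rpow_sub hy0,
    Real.rpow_neg hx0.le, Real.rpow_neg hy0.le]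
  congr 1
  field_simp

/-- Stein–Weiss inequality in the case `2δ + μ = d`, by the Schur test. -/
lemma stein_weiss_critical {E : Type*} [NormedAddCommGroup E] [SecondCountableTopology E]
    [MeasurableSpace E] [BorelSpace E] {m : Measure E} [SFinite m] [NullSingletonClass m] {A d μ δ : ℝ}
    (hA : 0 < A)
    (hm : ∀ (x : E) (r : ℝ), 0 < r → m (Metric.ball x r) ≤ ENNReal.ofReal (A * r ^ d))
    (hμ : 0 < μ) (hδ : 0 < δ) (hδμ : 2 * δ + μ = d) :
    ∃ C : ℝ, 0 < C ∧ ∀ f : E → ℝ, Measurable f → (∀ x, 0 ≤ f x) →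
      ∫⁻ x, ∫⁻ y, ENNReal.ofReal (f x * f y / (‖x‖ ^ δ * ‖x - y‖ ^ μ * ‖y‖ ^ δ)) ∂m ∂m ≤
        ENNReal.ofReal C * ∫⁻ x, ENNReal.ofReal (f x) ^ (2 : ℝ) ∂m := by
  obtain ⟨C, hC, h⟩ := lintegral_norm_rpow_mul_dist_rpow_le (β := d / 2 + δ) hA hm hμ.le (by linarith)
    (by linarith) (by linarith) (by linarith)
  refine ⟨2 * C, by positivity, fun f hf hf0 => ?_⟩
  have hne : ∀ᵐ y ∂m, y ≠ 0 := compl_mem_ae_iff.2 (measure_singleton 0)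
  refine (lintegral_lintegral_le_two_mul_of_le_add_swap (H := fun x y => ENNReal.ofReal (f x ^ 2 * ‖x‖ ^ (d / 2 - δ)) *
    ENNReal.ofReal (‖y‖ ^ (-(d / 2 + δ)) * dist x y ^ (-μ))) ?_ fun x y => ?_).trans ?_
  · have h1 : Measurable fun x => ENNReal.ofReal (f x ^ 2 * ‖x‖ ^ (d / 2 - δ)) :=
      ((hf.pow_const 2).mul (measurable_norm.pow_const _)).ennreal_ofReal
    have h2 : Measurable fun z : E × E =>
        ENNReal.ofReal (‖z.2‖ ^ (-(d / 2 + δ)) * dist z.1 z.2 ^ (-μ)) :=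
      ((measurable_snd.norm.pow_const _).mul (measurable_dist.pow_const _)).ennreal_ofReal
    exact (h1.comp measurable_fst).mul h2
  · have hfx := hf0 x
    have hfy := hf0 y
    by_cases hx : x = 0
    · simp [hx, Real.zero_rpow hδ.ne']
    by_cases hy : y = 0
    · simp [hy, Real.zero_rpow hδ.ne']
    have hx0 : 0 < ‖x‖ := norm_pos_iff.2 hx
    have hy0 : 0 < ‖y‖ := norm_pos_iff.2 hy
    rw [← ENNReal.ofReal_mul (by positivity), ← ENNReal.ofReal_mul (by positivity),
      ← ENNReal.ofReal_add (by positivity) (by positivity)]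
    refine ENNReal.ofReal_le_ofReal ?_
    rw [dist_comm y x, dist_eq_norm, Real.rpow_neg (norm_nonneg (x - y)), Real.rpow_sub hx0,
      Real.rpow_sub hy0, Real.rpow_neg hx0.le, Real.rpow_neg hy0.le, Real.rpow_add hx0,
      Real.rpow_add hy0]
    have ha : 0 < ‖x‖ ^ (d / 2) := by positivity
    have hb : 0 < ‖y‖ ^ (d / 2) := by positivity
    set a := ‖x‖ ^ (d / 2)
    set b := ‖y‖ ^ (d / 2)
    have key : f x * f y ≤ f x ^ 2 * (a / b) + f y ^ 2 * (b / a) := by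
      have h1 : f x ^ 2 * (a / b) + f y ^ 2 * (b / a) - f x * f y =
          ((f x * a - f y * b) ^ 2 + f x * a * (f y * b)) / (a * b) := by
        field_simp; ring
      have h2 : 0 ≤ ((f x * a - f y * b) ^ 2 + f x * a * (f y * b)) / (a * b) := by positivity
      linarith
    calc f x * f y / (‖x‖ ^ δ * ‖x - y‖ ^ μ * ‖y‖ ^ δ)
        ≤ (f x ^ 2 * (a / b) + f y ^ 2 * (b / a)) / (‖x‖ ^ δ * ‖x - y‖ ^ μ * ‖y‖ ^ δ) := by
          gcongr
      _ = _ := by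
          simp only [div_eq_mul_inv, mul_inv]
          ring
  · have key : ∀ x, x ≠ 0 → ∫⁻ y, (ENNReal.ofReal (f x ^ 2 * ‖x‖ ^ (d / 2 - δ)) *
        ENNReal.ofReal (‖y‖ ^ (-(d / 2 + δ)) * dist x y ^ (-μ))) ∂m ≤
        ENNReal.ofReal C * ENNReal.ofReal (f x) ^ (2 : ℝ) := by
      intro x hx
      have hx0 : 0 < ‖x‖ := norm_pos_iff.2 hx
      rw [lintegral_const_mul' _ _ ENNReal.ofReal_ne_top]
      refine (mul_le_mul_right (h x hx) _).trans_eq ?_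
      rw [ENNReal.ofReal_rpow_of_nonneg (hf0 x) (by norm_num), ← ENNReal.ofReal_mul (by positivity),
        ← ENNReal.ofReal_mul hC.le, mul_mul_mul_comm, mul_right_comm, mul_assoc,
        mul_left_comm, ← Real.rpow_add hx0,
        show d / 2 - δ + (d - (d / 2 + δ) - μ) = 0 by linarith, Real.rpow_zero, Real.rpow_two]
      ring_nf
    refine (mul_le_mul_right (lintegral_mono_ae (hne.mono key)) _).trans_eq ?_
    rw [lintegral_const_mul' _ _ ENNReal.ofReal_ne_top, ← mul_assoc,
      ENNReal.ofReal_mul (by norm_num : (0 : ℝ) ≤ 2), ENNReal.ofReal_ofNat]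

/-- Doubly weighted Hardy–Littlewood–Sobolev (Stein–Weiss) estimate for the Choquard energy
in terms of the critical Lebesgue norm. -/
theorem stein_weiss_choquard_estimate
    (N : ℕ) (s p θ₁ θ₂ θ μ δ : ℝ)
    (hN : 1 ≤ N) (hs0 : 0 < s) (hs1 : s < 1) (hp : 1 < p)
    (hθ : θ = θ₁ + θ₂)
    (hspθ0 : 0 < s * p + θ) (hspθ : s * p + θ < (N : ℝ))
    (hμ0 : 0 < μ) (hμN : μ < (N : ℝ))
    (hδ0 : 0 ≤ δ) (hδμ : 2 * δ + μ ≤ (N : ℝ)) :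
    ∃ C : ℝ, 0 < C ∧ ∀ u : EuclideanSpace ℝ (Fin N) → ℝ, Measurable u →
      (∫⁻ x, ∫⁻ y, ENNReal.ofReal
          (|u x| ^ (pSharp N s p θ δ μ) * |u y| ^ (pSharp N s p θ δ μ) /
            (‖x‖ ^ δ * ‖x - y‖ ^ μ * ‖y‖ ^ δ)))
        ≤ ENNReal.ofReal C *
          (∫⁻ x, ENNReal.ofReal (|u x| ^ (pStar N s p θ 0)))
            ^ (2 * ((N : ℝ) - δ - μ / 2) / (N : ℝ)) := by
  have hN0 : (0 : ℝ) < N := by exact_mod_cast hN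
  have : Nonempty (Fin N) := ⟨⟨0, hN⟩⟩
  have hD : 0 < (N : ℝ) - δ - μ / 2 := by linarith
  have hden : 0 < (N : ℝ) - s * p - θ := by linarith
  have hstar : pStar N s p θ 0 = pSharp N s p θ δ μ * ((N : ℝ) / ((N : ℝ) - δ - μ / 2)) := by
    rw [pStar, pSharp, sub_zero]
    generalize (N : ℝ) - δ - μ / 2 = D at hD
    field_simp
  have hexp : 2 * ((N : ℝ) - δ - μ / 2) / N = 2 / ((N : ℝ) / ((N : ℝ) - δ - μ / 2)) := by
    field_simp
  obtain ⟨A, hA, hm⟩ := addHaar_ball_le_rpow (volume : Measure (EuclideanSpace ℝ (Fin N)))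
  rw [finrank_euclideanSpace_fin] at hm
  obtain ⟨C, hC, h⟩ : ∃ C : ℝ, 0 < C ∧ ∀ f : EuclideanSpace ℝ (Fin N) → ℝ, Measurable f →
      (∀ x, 0 ≤ f x) →
      ∫⁻ x, ∫⁻ y, ENNReal.ofReal (f x * f y / (‖x‖ ^ δ * ‖x - y‖ ^ μ * ‖y‖ ^ δ)) ≤
        ENNReal.ofReal C * (∫⁻ x, ENNReal.ofReal (f x) ^ ((N : ℝ) / ((N : ℝ) - δ - μ / 2))) ^
          (2 / ((N : ℝ) / ((N : ℝ) - δ - μ / 2))) := by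
    rcases hδμ.lt_or_eq with hlt | heq
    · exact stein_weiss_subcritical hA hm hμ0 hδ0 hlt rfl
    · have ht : (N : ℝ) / ((N : ℝ) - δ - μ / 2) = 2 := by
        rw [div_eq_iff hD.ne']; linarith
      rw [ht, div_self (two_ne_zero' ℝ)]
      simp only [ENNReal.rpow_one]
      exact stein_weiss_critical hA hm hμ0 (by linarith) heq
  refine ⟨C, hC, fun u hu => ?_⟩
  rw [hexp]
  refine (h (fun x => |u x| ^ pSharp N s p θ δ μ) (hu.abs.pow_const _)
    fun x => by positivity).trans_eq ?_
  congr 2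
  refine lintegral_congr fun x => ?_
  rw [ENNReal.ofReal_rpow_of_nonneg (by positivity) (by positivity),
    ← Real.rpow_mul (abs_nonneg _), hstar]
end
end

section
/- Let N ≥ 1, r > 1, q ∈ [1, r], and δ ∈ [0, Nq/r). Let (w_k) be a sequence of measurable functions on ℝ^N with sup_k ∫_{ℝ^N} |w_k(x)|^r |x|^{−δr/q} dx < ∞ and suppose w_k → w almost everywhere on ℝ^N. Then lim_{k→∞} ∫_{ℝ^N} | |w_k(x)|^q |x|^{−δ} − |w_k(x)−w(x)|^q |x|^{−δ} − |w(x)|^q |x|^{−δ} |^{r/q} dx = 0. -/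
open MeasureTheory ENNReal Filter Topology

noncomputable section

/-- Young-type convexity inequality with weights `t` and `1 - t`. -/
lemma add_rpow_le_weighted {q t a b : ℝ} (hq : 1 ≤ q) (ht0 : 0 < t) (ht1 : t < 1)
    (ha : 0 ≤ a) (hb : 0 ≤ b) :
    (a + b) ^ q ≤ t ^ (1 - q) * a ^ q + (1 - t) ^ (1 - q) * b ^ q := by
  have ht : 0 < 1 - t := by linarith
  have h := (convexOn_rpow hq).2 (x := a / t) (y := b / (1 - t))
    (div_nonneg ha ht0.le) (div_nonneg hb ht.le) ht0.le ht.le (by ring)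
  simp only [smul_eq_mul] at h
  rw [mul_div_cancel₀ _ ht0.ne', mul_div_cancel₀ _ ht.ne', Real.div_rpow ha ht0.le,
    Real.div_rpow hb ht.le] at h
  rw [Real.rpow_sub ht0, Real.rpow_sub ht, Real.rpow_one, Real.rpow_one]
  refine h.trans_eq ?_
  ring

lemma exists_add_rpow_le {q ε : ℝ} (hq : 1 ≤ q) (hε : 0 < ε) :
    ∃ C : ℝ, 0 ≤ C ∧ ∀ a b : ℝ, 0 ≤ a → 0 ≤ b →
      (a + b) ^ q ≤ (1 + ε) * a ^ q + C * b ^ q := by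
  have hcont : Tendsto (fun t : ℝ => t ^ (1 - q)) (𝓝[<] 1) (𝓝 1) := by
    have h := (Real.continuousAt_rpow_const 1 (1 - q) (Or.inl one_ne_zero)).tendsto
    rw [Real.one_rpow] at h
    exact h.mono_left nhdsWithin_le_nhds
  have hlt : ∀ᶠ t : ℝ in 𝓝[<] 1, t ^ (1 - q) < 1 + ε :=
    hcont.eventually_lt_const (by linarith)
  obtain ⟨t, ht, ht0, ht1⟩ := (hlt.and (Ioo_mem_nhdsLT (zero_lt_one' ℝ))).exists
  refine ⟨(1 - t) ^ (1 - q), Real.rpow_nonneg (by linarith) _, fun a b ha hb => ?_⟩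
  refine (add_rpow_le_weighted hq ht0 ht1 ha hb).trans ?_
  gcongr

lemma exists_abs_rpow_sub_le {q ε : ℝ} (hq : 1 ≤ q) (hε : 0 < ε) :
    ∃ C : ℝ, 0 ≤ C ∧ ∀ u v : ℝ,
      |(|u + v| ^ q - |u| ^ q - |v| ^ q)| ≤ ε * |u| ^ q + C * |v| ^ q := by
  set η := min (ε / 2) 1
  have hη0 : 0 < η := lt_min (by linarith) one_pos
  have hη1 : η ≤ 1 := min_le_right _ _
  have hηε : η ≤ ε / 2 := min_le_left _ _
  obtain ⟨C, hC, h⟩ := exists_add_rpow_le hq hη0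
  refine ⟨2 * C + 1, by linarith, fun u v => ?_⟩
  have h₁ : |u + v| ^ q ≤ (1 + η) * |u| ^ q + C * |v| ^ q :=
    (Real.rpow_le_rpow (abs_nonneg _) (abs_add_le u v) (by linarith)).trans
      (h _ _ (abs_nonneg _) (abs_nonneg _))
  have h₂ : |u| ^ q ≤ (1 + η) * |u + v| ^ q + C * |v| ^ q := by
    refine (Real.rpow_le_rpow (abs_nonneg _) ?_ (by linarith)).trans
      (h _ _ (abs_nonneg _) (abs_nonneg _))
    simpa using abs_sub (u + v) v
  have hu : 0 ≤ |u| ^ q := by positivity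
  have hv : 0 ≤ |v| ^ q := by positivity
  have hCv : 0 ≤ C * |v| ^ q := by positivity
  have h₃ := mul_le_mul_of_nonneg_left h₁ hη0.le
  have h₄ : η * (C * |v| ^ q) ≤ C * |v| ^ q := mul_le_of_le_one_left hCv hη1
  have h₅ : η * |u| ^ q ≤ ε / 2 * |u| ^ q := mul_le_mul_of_nonneg_right hηε hu
  have h₆ : η * (η * |u| ^ q) ≤ η * |u| ^ q := mul_le_of_le_one_left (by positivity) hη1
  rw [abs_le]
  constructor <;> nlinarith

lemma exists_abs_rpow_sub_rpow_le {q p ε : ℝ} (hq : 1 ≤ q) (hp : 1 ≤ p) (hε : 0 < ε) :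
    ∃ C : ℝ, 0 ≤ C ∧ ∀ u v : ℝ,
      |(|u + v| ^ q - |u| ^ q - |v| ^ q)| ^ p ≤ ε * |u| ^ (q * p) + C * |v| ^ (q * p) := by
  have hp0 : 0 < p := by linarith
  obtain ⟨C, hC, h⟩ := exists_abs_rpow_sub_le hq (ε := (ε / 2) ^ p⁻¹) (by positivity)
  obtain ⟨D, hD, h'⟩ := exists_add_rpow_le hp one_pos
  refine ⟨D * C ^ p, by positivity, fun u v => ?_⟩
  refine (Real.rpow_le_rpow (abs_nonneg _) (h u v) hp0.le).trans
    ((h' _ _ (by positivity) (by positivity)).trans_eq ?_)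
  rw [Real.mul_rpow (by positivity) (by positivity), Real.mul_rpow hC (by positivity),
    ← Real.rpow_mul (abs_nonneg u), ← Real.rpow_mul (abs_nonneg v),
    ← Real.rpow_mul (by positivity), inv_mul_cancel₀ hp0.ne', Real.rpow_one]
  ring

/-- The Brézis–Lieb lemma in its strong form, on an arbitrary measure space. -/
theorem tendsto_lintegral_brezis_lieb {α : Type*} [MeasurableSpace α] {μ : Measure α}
    {q p : ℝ} (hq : 1 ≤ q) (hp : 1 ≤ p) {f : ℕ → α → ℝ} {g : α → ℝ}
    (hf : ∀ k, Measurable (f k)) (hg : Measurable g) {M : ℝ≥0∞} (hM : M ≠ ∞)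
    (hbdd : ∀ k, ∫⁻ x, ENNReal.ofReal (|f k x| ^ (q * p)) ∂μ ≤ M)
    (hlim : ∀ᵐ x ∂μ, Tendsto (fun k => f k x) atTop (𝓝 (g x))) :
    Tendsto (fun k => ∫⁻ x, ENNReal.ofReal
      (|(|f k x| ^ q - |f k x - g x| ^ q - |g x| ^ q)| ^ p) ∂μ) atTop (𝓝 0) := by
  have hq0 : 0 < q := by linarith
  have hp0 : 0 < p := by linarith
  have hqp : 1 ≤ q * p := one_le_mul_of_one_le_of_one_le hq hp
  have hqp0 : 0 < q * p := by positivity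
  have hgM : ∫⁻ x, ENNReal.ofReal (|g x| ^ (q * p)) ∂μ ≤ M := by
    calc ∫⁻ x, ENNReal.ofReal (|g x| ^ (q * p)) ∂μ
        = ∫⁻ x, liminf (fun k => ENNReal.ofReal (|f k x| ^ (q * p))) atTop ∂μ := by
          refine lintegral_congr_ae (hlim.mono fun x hx => ?_)
          exact (ENNReal.tendsto_ofReal
            (hx.abs.rpow_const (Or.inr hqp0.le))).liminf_eq.symm
      _ ≤ liminf (fun k => ∫⁻ x, ENNReal.ofReal (|f k x| ^ (q * p)) ∂μ) atTop :=
          lintegral_liminf_le fun k => by have := hf k; fun_prop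
      _ ≤ M := (liminf_le_liminf (Eventually.of_forall hbdd)).trans_eq (liminf_const M)
  obtain ⟨D, hD, hD'⟩ := exists_add_rpow_le hqp one_pos
  set K : ℝ≥0∞ := 2 * M + ENNReal.ofReal D * M
  have hK : K ≠ ∞ := by finiteness
  have hfgK : ∀ k, ∫⁻ x, ENNReal.ofReal (|f k x - g x| ^ (q * p)) ∂μ ≤ K := by
    intro k
    calc ∫⁻ x, ENNReal.ofReal (|f k x - g x| ^ (q * p)) ∂μ
        ≤ ∫⁻ x, (2 * ENNReal.ofReal (|f k x| ^ (q * p))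
            + ENNReal.ofReal D * ENNReal.ofReal (|g x| ^ (q * p))) ∂μ := by
          refine lintegral_mono fun x => ?_
          rw [← ENNReal.ofReal_ofNat 2, ← ENNReal.ofReal_mul (by norm_num),
            ← ENNReal.ofReal_mul hD, ← ENNReal.ofReal_add (by positivity) (by positivity)]
          refine ENNReal.ofReal_le_ofReal ?_
          refine (Real.rpow_le_rpow (abs_nonneg _) (abs_sub _ _) hqp0.le).trans ?_
          refine (hD' _ _ (abs_nonneg _) (abs_nonneg _)).trans_eq ?_
          norm_num
      _ = 2 * ∫⁻ x, ENNReal.ofReal (|f k x| ^ (q * p)) ∂μ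
            + ENNReal.ofReal D * ∫⁻ x, ENNReal.ofReal (|g x| ^ (q * p)) ∂μ := by
          have := hf k
          rw [lintegral_add_left (by fun_prop), lintegral_const_mul _ (by fun_prop),
            lintegral_const_mul _ (by fun_prop)]
      _ ≤ K := add_le_add (mul_le_mul_right (hbdd k) _) (mul_le_mul_right hgM _)
  set F : ℕ → α → ℝ := fun k x => |(|f k x| ^ q - |f k x - g x| ^ q - |g x| ^ q)| ^ p
  have hFm : ∀ k, Measurable (F k) := fun k => by have := hf k; fun_prop
  have hF0 : ∀ᵐ x ∂μ, Tendsto (fun k => F k x) atTop (𝓝 0) := by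
    filter_upwards [hlim] with x hx
    have hsub : Tendsto (fun k => f k x - g x) atTop (𝓝 0) := by
      simpa using hx.sub_const (g x)
    have h := (((hx.abs.rpow_const (Or.inr hq0.le)).sub
      (hsub.abs.rpow_const (Or.inr hq0.le))).sub_const (|g x| ^ q)).abs.rpow_const
      (p := p) (Or.inr hp0.le)
    simpa [Real.zero_rpow hq0.ne', Real.zero_rpow hp0.ne'] using h
  have key : ∀ ε : ℝ, 0 < ε →
      limsup (fun k => ∫⁻ x, ENNReal.ofReal (F k x) ∂μ) atTop ≤ ENNReal.ofReal ε * K := by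
    intro ε hε
    obtain ⟨C, hC, hle⟩ := exists_abs_rpow_sub_rpow_le hq hp hε
    have hdom : Tendsto (fun k => ∫⁻ x, ENNReal.ofReal
        (F k x - ε * |f k x - g x| ^ (q * p)) ∂μ) atTop (𝓝 (∫⁻ _, 0 ∂μ)) := by
      refine tendsto_lintegral_of_dominated_convergence
        (fun x => ENNReal.ofReal C * ENNReal.ofReal (|g x| ^ (q * p)))
        (fun k => ?_) (fun k => Eventually.of_forall fun x => ?_) ?_ ?_
      · have := hf k
        have := hFm k
        fun_prop
      · beta_reduce
        rw [← ENNReal.ofReal_mul hC]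
        refine ENNReal.ofReal_le_ofReal ?_
        have h := hle (f k x - g x) (g x)
        rw [sub_add_cancel] at h
        simp only [F]
        linarith
      · rw [lintegral_const_mul _ (by fun_prop)]
        exact ENNReal.mul_ne_top ENNReal.ofReal_ne_top (ne_top_of_le_ne_top hM hgM)
      · filter_upwards [hF0] with x hx
        have h := ENNReal.tendsto_ofReal hx
        rw [ENNReal.ofReal_zero] at h
        refine tendsto_of_tendsto_of_tendsto_of_le_of_le tendsto_const_nhds h
          (fun _ => zero_le) fun k => ENNReal.ofReal_le_ofReal ?_
        have : 0 ≤ ε * |f k x - g x| ^ (q * p) := by positivity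
        linarith
    rw [lintegral_zero] at hdom
    have hbound : ∀ k, ∫⁻ x, ENNReal.ofReal (F k x) ∂μ ≤
        ∫⁻ x, ENNReal.ofReal (F k x - ε * |f k x - g x| ^ (q * p)) ∂μ
          + ENNReal.ofReal ε * K := by
      intro k
      have := hf k
      have := hFm k
      calc ∫⁻ x, ENNReal.ofReal (F k x) ∂μ
          ≤ ∫⁻ x, (ENNReal.ofReal (F k x - ε * |f k x - g x| ^ (q * p))
              + ENNReal.ofReal ε * ENNReal.ofReal (|f k x - g x| ^ (q * p))) ∂μ := by
            refine lintegral_mono fun x => ?_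
            rw [← ENNReal.ofReal_mul hε.le]
            refine le_trans (ENNReal.ofReal_le_ofReal ?_) ENNReal.ofReal_add_le
            linarith
        _ ≤ _ := by
            rw [lintegral_add_left (by fun_prop), lintegral_const_mul _ (by fun_prop)]
            gcongr
            exact hfgK k
    have hlimsup := (hdom.add_const (ENNReal.ofReal ε * K)).limsup_eq
    rw [zero_add] at hlimsup
    exact (limsup_le_limsup (Eventually.of_forall hbound)).trans_eq hlimsup
  have hzero : Tendsto (fun ε : ℝ => ENNReal.ofReal ε * K) (𝓝[>] 0) (𝓝 0) := by
    have h := ENNReal.Tendsto.mul_const (b := K)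
      (ENNReal.tendsto_ofReal (tendsto_id (α := ℝ) (x := 𝓝 0))) (Or.inr hK)
    simp only [ENNReal.ofReal_zero, zero_mul, id] at h
    exact h.mono_left nhdsWithin_le_nhds
  have hlimsup0 : limsup (fun k => ∫⁻ x, ENNReal.ofReal (F k x) ∂μ) atTop ≤ 0 :=
    ge_of_tendsto hzero (eventually_mem_nhdsWithin.mono fun ε hε => key ε hε)
  exact tendsto_of_le_liminf_of_limsup_le zero_le hlimsup0

/-- Weighted variant of the Brézis–Lieb lemma. -/
theorem weighted_brezis_lieb
    (N : ℕ) (r q δ : ℝ)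
    (hN : 1 ≤ N) (hr : 1 < r) (hq1 : 1 ≤ q) (hqr : q ≤ r)
    (hδ0 : 0 ≤ δ) (hδ : δ < (N : ℝ) * q / r)
    (w : ℕ → EuclideanSpace ℝ (Fin N) → ℝ) (w₀ : EuclideanSpace ℝ (Fin N) → ℝ)
    (hwm : ∀ k, Measurable (w k)) (hw₀m : Measurable w₀)
    (hbdd : ∃ M : ℝ, ∀ k,
      ∫⁻ x, ENNReal.ofReal (|w k x| ^ r * ‖x‖ ^ (-(δ * r / q))) ≤ ENNReal.ofReal M)
    (hae : ∀ᵐ x : EuclideanSpace ℝ (Fin N),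
      Tendsto (fun k => w k x) atTop (𝓝 (w₀ x))) :
    Tendsto (fun k => ∫ x,
        abs (|w k x| ^ q * ‖x‖ ^ (-δ) - |w k x - w₀ x| ^ q * ‖x‖ ^ (-δ)
          - |w₀ x| ^ q * ‖x‖ ^ (-δ)) ^ (r / q))
      atTop (𝓝 0) := by
  obtain ⟨M, hM⟩ := hbdd
  have hq0 : 0 < q := by linarith
  have hp : 1 ≤ r / q := (one_le_div hq0).2 hqr
  have hqp : q * (r / q) = r := mul_div_cancel₀ r hq0.ne'
  set ρ : EuclideanSpace ℝ (Fin N) → ℝ := fun x => ‖x‖ ^ (-δ / q)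
  have hρ0 : ∀ x, 0 ≤ ρ x := fun x => Real.rpow_nonneg (norm_nonneg x) _
  have hρm : Measurable ρ := by fun_prop
  have hweight : ∀ (t s : ℝ) (x : EuclideanSpace ℝ (Fin N)),
      |t * ρ x| ^ s = |t| ^ s * ‖x‖ ^ (-δ / q * s) := fun t s x => by
    rw [abs_mul, abs_of_nonneg (hρ0 x), Real.mul_rpow (abs_nonneg t) (hρ0 x),
      ← Real.rpow_mul (norm_nonneg x)]
  have hδq : -δ / q * q = -δ := div_mul_cancel₀ _ hq0.ne'
  have hδr : -δ / q * r = -(δ * r / q) := by ring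
  have h := tendsto_lintegral_brezis_lieb (μ := volume) hq1 hp
    (f := fun k x => w k x * ρ x) (g := fun x => w₀ x * ρ x)
    (fun k => (hwm k).mul hρm) (hw₀m.mul hρm) (M := ENNReal.ofReal M) ENNReal.ofReal_ne_top
    (fun k => by simpa only [hqp, hweight, hδr] using hM k)
    (hae.mono fun x hx => hx.mul_const (ρ x))
  simp only [← sub_mul] at h
  simp only [hweight, hδq] at h
  have h' := (ENNReal.tendsto_toReal ENNReal.zero_ne_top).comp h
  rw [ENNReal.toReal_zero] at h'
  refine h'.congr fun k => ?_
  have := hwm k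
  refine (integral_eq_lintegral_of_nonneg_ae (Eventually.of_forall fun x => ?_) ?_).symm
  · exact Real.rpow_nonneg (abs_nonneg _) _
  · exact Measurable.aestronglyMeasurable (by fun_prop)
end
end

section
/- Let N ≥ 1, r > 1, q ∈ [1, r], and δ ∈ [0, Nq/r). Let (w_k) be a sequence of measurable functions on ℝ^N with sup_k ∫_{ℝ^N} |w_k(x)|^r |x|^{−δr/q} dx < ∞ and suppose w_k → w almost everywhere on ℝ^N. Then lim_{k→∞} ∫_{ℝ^N} | |w_k(x)|^{q−1}w_k(x) |x|^{−δ} − |w_k(x)−w(x)|^{q−1}(w_k(x)−w(x)) |x|^{−δ} − |w(x)|^{q−1}w(x) |x|^{−δ} |^{r/q} dx = 0. -/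
open MeasureTheory ENNReal Filter Topology

noncomputable section

/-- The odd power function `t ↦ |t|^{q-1} t`. -/
def signedRpow (q t : ℝ) : ℝ := |t| ^ (q - 1) * t

theorem abs_signedRpow {q : ℝ} (hq : q ≠ 0) (t : ℝ) : |signedRpow q t| = |t| ^ q := by
  rw [signedRpow, abs_mul, abs_of_nonneg (Real.rpow_nonneg (abs_nonneg t) _)]
  rcases eq_or_ne t 0 with rfl | ht
  · simp [Real.zero_rpow hq]
  · rw [← Real.rpow_add_one (abs_ne_zero.mpr ht), sub_add_cancel]

theorem abs_signedRpow_rpow {q : ℝ} (hq : q ≠ 0) (r t : ℝ) :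
    |signedRpow q t| ^ (r / q) = |t| ^ r := by
  rw [abs_signedRpow hq, ← Real.rpow_mul (abs_nonneg t), mul_div_cancel₀ r hq]

theorem signedRpow_mul (q s t : ℝ) : signedRpow q (s * t) = signedRpow q s * signedRpow q t := by
  simp only [signedRpow, abs_mul, Real.mul_rpow (abs_nonneg s) (abs_nonneg t)]
  ring

theorem signedRpow_of_nonneg {q c : ℝ} (hq : q ≠ 0) (hc : 0 ≤ c) : signedRpow q c = c ^ q := by
  have h : 0 ≤ signedRpow q c := mul_nonneg (Real.rpow_nonneg (abs_nonneg c) _) hc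
  rw [← abs_of_nonneg h, abs_signedRpow hq, abs_of_nonneg hc]

@[simp]
theorem signedRpow_zero (q : ℝ) : signedRpow q 0 = 0 := by simp [signedRpow]

theorem continuous_signedRpow {q : ℝ} (hq : 1 ≤ q) : Continuous (signedRpow q) :=
  (continuous_abs.rpow_const fun _ => Or.inr (sub_nonneg.mpr hq)).mul continuous_id

/-- The Brézis–Lieb defect `| φ(a + b) - φ(a) - φ(b) |^{r/q}` of `φ t = |t|^{q-1} t`. -/
def signedRpowDefect (q r a b : ℝ) : ℝ :=
  |signedRpow q (a + b) - signedRpow q a - signedRpow q b| ^ (r / q)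

theorem signedRpowDefect_nonneg (q r a b : ℝ) : 0 ≤ signedRpowDefect q r a b :=
  Real.rpow_nonneg (abs_nonneg _) _

theorem continuous_signedRpowDefect {q r : ℝ} (hq : 1 ≤ q) (hqr : q ≤ r) :
    Continuous fun z : ℝ × ℝ => signedRpowDefect q r z.1 z.2 := by
  have h := continuous_signedRpow hq
  have hp : 0 ≤ r / q := div_nonneg (by linarith) (by linarith)
  exact Continuous.rpow_const (by fun_prop) fun _ => Or.inr hp

theorem signedRpowDefect_mul {q : ℝ} (hq : q ≠ 0) (r c a b : ℝ) :
    signedRpowDefect q r (c * a) (c * b) = |c| ^ r * signedRpowDefect q r a b := by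
  rw [signedRpowDefect, signedRpowDefect, ← mul_add, signedRpow_mul, signedRpow_mul,
    signedRpow_mul, ← mul_sub, ← mul_sub, abs_mul, Real.mul_rpow (abs_nonneg _) (abs_nonneg _),
    abs_signedRpow_rpow hq]

theorem signedRpowDefect_zero_right {q r : ℝ} (hq : 1 ≤ q) (hqr : q ≤ r) (a : ℝ) :
    signedRpowDefect q r a 0 = 0 := by
  have hp : r / q ≠ 0 := (div_pos (by linarith) (by linarith)).ne'
  simp [signedRpowDefect, Real.zero_rpow hp]

theorem signedRpowDefect_zero_left {q r : ℝ} (hq : 1 ≤ q) (hqr : q ≤ r) (b : ℝ) :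
    signedRpowDefect q r 0 b = 0 := by
  have hp : r / q ≠ 0 := (div_pos (by linarith) (by linarith)).ne'
  simp [signedRpowDefect, Real.zero_rpow hp]

theorem signedRpowDefect_le {q r : ℝ} (hq : 1 ≤ q) (hqr : q ≤ r) {ε : ℝ} (hε : 0 < ε) :
    ∃ C : ℝ, 0 ≤ C ∧ ∀ a b : ℝ, signedRpowDefect q r a b ≤ ε * |a| ^ r + C * |b| ^ r := by
  have hq0 : q ≠ 0 := by linarith
  have hG := continuous_signedRpowDefect hq hqr
  obtain ⟨η, hη, hsmall⟩ : ∃ η > 0, ∀ s : ℝ, |s| ≤ η → signedRpowDefect q r 1 s ≤ ε := by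
    have hlim : Tendsto (fun s : ℝ => signedRpowDefect q r 1 s) (𝓝 0) (𝓝 0) := by
      have h : Continuous fun s : ℝ => signedRpowDefect q r 1 s :=
        hG.comp (g := fun z : ℝ × ℝ => signedRpowDefect q r z.1 z.2)
          (f := fun s : ℝ => ((1 : ℝ), s)) (by fun_prop)
      simpa [signedRpowDefect_zero_right hq hqr] using h.tendsto 0
    obtain ⟨η, hη, h⟩ := Metric.eventually_nhds_iff.mp (hlim.eventually_lt_const hε)
    refine ⟨η / 2, half_pos hη, fun s hs => (h ?_).le⟩
    rw [Real.dist_eq, sub_zero]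
    linarith
  obtain ⟨C, hC⟩ : ∃ C : ℝ, ∀ t : ℝ, |t| ≤ η⁻¹ → signedRpowDefect q r t 1 ≤ C := by
    have h : Continuous fun t : ℝ => signedRpowDefect q r t 1 :=
      hG.comp (g := fun z : ℝ × ℝ => signedRpowDefect q r z.1 z.2)
        (f := fun t : ℝ => (t, (1 : ℝ))) (by fun_prop)
    obtain ⟨C, hC⟩ := (isCompact_Icc (a := -η⁻¹) (b := η⁻¹)).bddAbove_image h.continuousOn
    exact ⟨C, fun t ht => hC ⟨t, abs_le.mp ht, rfl⟩⟩
  have hC0 : 0 ≤ C := (signedRpowDefect_nonneg q r 0 1).trans (hC 0 (by simpa using hη.le))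
  refine ⟨C, hC0, fun a b => ?_⟩
  have hA : 0 ≤ |a| ^ r := Real.rpow_nonneg (abs_nonneg a) r
  have hB : 0 ≤ |b| ^ r := Real.rpow_nonneg (abs_nonneg b) r
  rcases eq_or_ne a 0 with rfl | ha
  · rw [signedRpowDefect_zero_left hq hqr]
    positivity
  rcases le_total |b| (η * |a|) with hba | hba
  · have h : signedRpowDefect q r a b = |a| ^ r * signedRpowDefect q r 1 (b / a) := by
      rw [← signedRpowDefect_mul hq0, mul_one, mul_div_cancel₀ b ha]
    have hs := hsmall (b / a) (by rwa [abs_div, div_le_iff₀ (abs_pos.mpr ha)])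
    nlinarith [mul_le_mul_of_nonneg_left hs hA, mul_nonneg hC0 hB]
  · have hb : b ≠ 0 := by
      rintro rfl
      have := mul_pos hη (abs_pos.mpr ha)
      rw [abs_zero] at hba
      linarith
    have h : signedRpowDefect q r a b = |b| ^ r * signedRpowDefect q r (a / b) 1 := by
      rw [← signedRpowDefect_mul hq0, mul_one, mul_div_cancel₀ a hb]
    have ht := hC (a / b) (by
      rw [abs_div, div_le_iff₀ (abs_pos.mpr hb), inv_mul_eq_div, le_div_iff₀ hη]
      linarith)
    nlinarith [mul_le_mul_of_nonneg_left ht hB, mul_nonneg hε.le hA]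

/-- Convergence part of the Brézis–Lieb lemma for an abstract defect `G`. -/
theorem tendsto_lintegral_zero_of_le_add {α : Type*} [MeasurableSpace α] {μ : Measure α}
    {G A : ℕ → α → ℝ≥0∞} {B : α → ℝ≥0∞}
    (hG : ∀ k, Measurable (G k)) (hA : ∀ k, Measurable (A k))
    {K : ℝ≥0∞} (hK : K ≠ ∞) (hAK : ∀ k, ∫⁻ x, A k x ∂μ ≤ K) (hB : ∫⁻ x, B x ∂μ ≠ ∞)
    (hlim : ∀ᵐ x ∂μ, Tendsto (fun k => G k x) atTop (𝓝 0))
    (hle : ∀ ε : ℝ≥0∞, 0 < ε → ε ≠ ∞ →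
      ∃ C : ℝ≥0∞, C ≠ ∞ ∧ ∀ k x, G k x ≤ ε * A k x + C * B x) :
    Tendsto (fun k => ∫⁻ x, G k x ∂μ) atTop (𝓝 0) := by
  have key : ∀ ε : ℝ≥0∞, 0 < ε → ε ≠ ∞ →
      ∀ᶠ k in atTop, ∫⁻ x, G k x ∂μ ≤ ε * (1 + K) := by
    intro ε hε hε'
    obtain ⟨C, hC, hGC⟩ := hle ε hε hε'
    have hD : Tendsto (fun k => ∫⁻ x, (G k x - ε * A k x) ∂μ) atTop (𝓝 0) := by
      rw [← lintegral_zero (μ := μ)]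
      refine tendsto_lintegral_of_dominated_convergence' (fun x => C * B x)
        (fun k => ((hG k).sub ((hA k).const_mul ε)).aemeasurable)
        (fun k => Eventually.of_forall fun x => tsub_le_iff_left.mpr (hGC k x)) ?_ ?_
      · rw [lintegral_const_mul' C B hC]
        exact ENNReal.mul_ne_top hC hB
      · filter_upwards [hlim] with x hx
        exact tendsto_of_tendsto_of_tendsto_of_le_of_le tendsto_const_nhds hx
          (fun _ => zero_le) fun _ => tsub_le_self
    filter_upwards [hD.eventually_le_const hε] with k hk
    calc ∫⁻ x, G k x ∂μ ≤ ∫⁻ x, ((G k x - ε * A k x) + ε * A k x) ∂μ :=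
          lintegral_mono fun x => le_tsub_add
      _ = ∫⁻ x, (G k x - ε * A k x) ∂μ + ε * ∫⁻ x, A k x ∂μ := by
          rw [lintegral_add_right _ ((hA k).const_mul ε), lintegral_const_mul ε (hA k)]
      _ ≤ ε + ε * K := by gcongr; exact hAK k
      _ = ε * (1 + K) := by ring
  rw [ENNReal.tendsto_nhds_zero]
  intro ε hε
  have hK1 : 1 + K ≠ ∞ := ENNReal.add_ne_top.mpr ⟨ENNReal.one_ne_top, hK⟩
  have hpos : 0 < min ε 1 / (1 + K) :=
    ENNReal.div_pos (lt_min hε one_pos).ne' hK1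
  have hK0 : 1 + K ≠ 0 := (one_pos.trans_le le_self_add).ne'
  have htop : min ε 1 / (1 + K) ≠ ∞ :=
    ENNReal.div_ne_top (ne_top_of_le_ne_top ENNReal.one_ne_top (min_le_right _ _)) hK0
  filter_upwards [key _ hpos htop] with k hk
  rw [ENNReal.div_mul_cancel hK0 hK1] at hk
  exact hk.trans (min_le_left _ _)

/-- The Brézis–Lieb lemma for the signed powers `t ↦ |t|^{q-1} t`. -/
theorem tendsto_lintegral_signedRpowDefect {α : Type*} [MeasurableSpace α] {μ : Measure α}
    {q r : ℝ} (hq : 1 ≤ q) (hqr : q ≤ r) {u : ℕ → α → ℝ} {u₀ : α → ℝ}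
    (hu : ∀ k, Measurable (u k)) (hu₀ : Measurable u₀) {M : ℝ≥0∞} (hM : M ≠ ∞)
    (hbdd : ∀ k, ∫⁻ x, ENNReal.ofReal (|u k x| ^ r) ∂μ ≤ M)
    (hae : ∀ᵐ x ∂μ, Tendsto (fun k => u k x) atTop (𝓝 (u₀ x))) :
    Tendsto (fun k => ∫⁻ x, ENNReal.ofReal (signedRpowDefect q r (u k x - u₀ x) (u₀ x)) ∂μ)
      atTop (𝓝 0) := by
  have hr1 : 1 ≤ r := hq.trans hqr
  have hr0 : 0 ≤ r := zero_le_one.trans hr1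
  have hGc := continuous_signedRpowDefect hq hqr
  have hB : ∫⁻ x, ENNReal.ofReal (|u₀ x| ^ r) ∂μ ≤ M := by
    calc ∫⁻ x, ENNReal.ofReal (|u₀ x| ^ r) ∂μ
        = ∫⁻ x, liminf (fun k => ENNReal.ofReal (|u k x| ^ r)) atTop ∂μ := by
          refine lintegral_congr_ae ?_
          filter_upwards [hae] with x hx
          exact ((ENNReal.tendsto_ofReal (hx.abs.rpow_const (Or.inr hr0))).liminf_eq).symm
      _ ≤ liminf (fun k => ∫⁻ x, ENNReal.ofReal (|u k x| ^ r) ∂μ) atTop :=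
          lintegral_liminf_le fun k => by have := hu k; fun_prop
      _ ≤ M := by
          refine liminf_le_of_le (by isBoundedDefault) fun b hb => ?_
          obtain ⟨k, hk⟩ := hb.exists
          exact hk.trans (hbdd k)
  have hsub : ∀ s t : ℝ, ENNReal.ofReal (|s - t| ^ r) ≤
      2 ^ (r - 1) * (ENNReal.ofReal (|s| ^ r) + ENNReal.ofReal (|t| ^ r)) := by
    intro s t
    simp only [← ENNReal.ofReal_rpow_of_nonneg (abs_nonneg _) hr0]
    refine (ENNReal.rpow_le_rpow ?_ hr0).trans (ENNReal.rpow_add_le_mul_rpow_add_rpow _ _ hr1)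
    rw [← ENNReal.ofReal_add (abs_nonneg _) (abs_nonneg _)]
    exact ENNReal.ofReal_le_ofReal (abs_sub s t)
  have h2 : (2 : ℝ≥0∞) ^ (r - 1) ≠ ∞ :=
    ENNReal.rpow_ne_top_of_nonneg (by linarith) ENNReal.ofNat_ne_top
  refine tendsto_lintegral_zero_of_le_add
    (A := fun k x => ENNReal.ofReal (|u k x - u₀ x| ^ r))
    (B := fun x => ENNReal.ofReal (|u₀ x| ^ r)) (K := 2 ^ (r - 1) * (M + M))
    (fun k => ?_) (fun k => ?_) (ENNReal.mul_ne_top h2 (ENNReal.add_ne_top.mpr ⟨hM, hM⟩))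
    (fun k => ?_) (ne_top_of_le_ne_top hM hB) ?_ fun ε hε hε' => ?_
  · exact (hGc.measurable.comp (((hu k).sub hu₀).prodMk hu₀)).ennreal_ofReal
  · have := hu k
    fun_prop
  · calc ∫⁻ x, ENNReal.ofReal (|u k x - u₀ x| ^ r) ∂μ
        ≤ ∫⁻ x, 2 ^ (r - 1) * (ENNReal.ofReal (|u k x| ^ r) + ENNReal.ofReal (|u₀ x| ^ r)) ∂μ :=
          lintegral_mono fun x => hsub _ _
      _ = 2 ^ (r - 1) *
          (∫⁻ x, ENNReal.ofReal (|u k x| ^ r) ∂μ + ∫⁻ x, ENNReal.ofReal (|u₀ x| ^ r) ∂μ) := by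
          rw [lintegral_const_mul' _ _ h2, lintegral_add_right _ (by fun_prop)]
      _ ≤ 2 ^ (r - 1) * (M + M) := by gcongr; exact hbdd k
  · filter_upwards [hae] with x hx
    have hx0 : Tendsto (fun k => (u k x - u₀ x, u₀ x)) atTop (𝓝 (0, u₀ x)) := by
      refine Tendsto.prodMk_nhds ?_ tendsto_const_nhds
      simpa using hx.sub_const (u₀ x)
    have h := ENNReal.tendsto_ofReal ((hGc.tendsto (0, u₀ x)).comp hx0)
    simpa [signedRpowDefect_zero_left hq hqr] using h
  · obtain ⟨C, hC, hGC⟩ := signedRpowDefect_le hq hqr (ENNReal.toReal_pos hε.ne' hε')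
    refine ⟨ENNReal.ofReal C, ENNReal.ofReal_ne_top, fun k x => ?_⟩
    refine (ENNReal.ofReal_le_ofReal (hGC _ _)).trans_eq ?_
    rw [ENNReal.ofReal_add (by positivity) (by positivity), ENNReal.ofReal_mul (by positivity),
      ENNReal.ofReal_mul hC, ENNReal.ofReal_toReal hε']

/-- Weighted variant of the Brézis–Lieb lemma for the signed powers `t ↦ |t|^{q-1} t`. -/
theorem weighted_brezis_lieb_signed
    (N : ℕ) (r q δ : ℝ)
    (hN : 1 ≤ N) (hr : 1 < r) (hq1 : 1 ≤ q) (hqr : q ≤ r)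
    (hδ0 : 0 ≤ δ) (hδ : δ < (N : ℝ) * q / r)
    (w : ℕ → EuclideanSpace ℝ (Fin N) → ℝ) (w₀ : EuclideanSpace ℝ (Fin N) → ℝ)
    (hwm : ∀ k, Measurable (w k)) (hw₀m : Measurable w₀)
    (hbdd : ∃ M : ℝ, ∀ k,
      ∫⁻ x, ENNReal.ofReal (|w k x| ^ r * ‖x‖ ^ (-(δ * r / q))) ≤ ENNReal.ofReal M)
    (hae : ∀ᵐ x : EuclideanSpace ℝ (Fin N),
      Tendsto (fun k => w k x) atTop (𝓝 (w₀ x))) :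
    Tendsto (fun k => ∫ x,
        abs (|w k x| ^ (q - 1) * w k x * ‖x‖ ^ (-δ)
          - |w k x - w₀ x| ^ (q - 1) * (w k x - w₀ x) * ‖x‖ ^ (-δ)
          - |w₀ x| ^ (q - 1) * w₀ x * ‖x‖ ^ (-δ)) ^ (r / q))
      atTop (𝓝 0) := by
  obtain ⟨M, hM⟩ := hbdd
  have hq0 : q ≠ 0 := by linarith
  have hc : ∀ x : EuclideanSpace ℝ (Fin N), 0 ≤ ‖x‖ ^ (-δ / q) := fun x =>
    Real.rpow_nonneg (norm_nonneg x) _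
  have hcq : ∀ x : EuclideanSpace ℝ (Fin N), signedRpow q (‖x‖ ^ (-δ / q)) = ‖x‖ ^ (-δ) := by
    intro x
    rw [signedRpow_of_nonneg hq0 (hc x), ← Real.rpow_mul (norm_nonneg x), div_mul_cancel₀ _ hq0]
  have hcm : Measurable fun x : EuclideanSpace ℝ (Fin N) => ‖x‖ ^ (-δ / q) := by fun_prop
  have key := tendsto_lintegral_signedRpowDefect hq1 hqr
    (u := fun k x => ‖x‖ ^ (-δ / q) * w k x) (u₀ := fun x => ‖x‖ ^ (-δ / q) * w₀ x)
    (fun k => hcm.mul (hwm k)) (hcm.mul hw₀m) (M := ENNReal.ofReal M) ENNReal.ofReal_ne_top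
    (μ := volume) (fun k => by
      refine le_trans (le_of_eq (lintegral_congr fun x => ?_)) (hM k)
      rw [abs_mul, abs_of_nonneg (hc x), Real.mul_rpow (hc x) (abs_nonneg _),
        ← Real.rpow_mul (norm_nonneg x), mul_comm]
      congr 3
      ring)
    (by filter_upwards [hae] with x hx using hx.const_mul _)
  have hreal := (ENNReal.tendsto_toReal ENNReal.zero_ne_top).comp key
  rw [ENNReal.toReal_zero] at hreal
  refine hreal.congr fun k => ?_
  rw [Function.comp_apply, integral_eq_lintegral_of_nonneg_ae]
  · congr 1
    refine lintegral_congr fun x => ?_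
    rw [signedRpowDefect, sub_add_cancel, ← mul_sub, signedRpow_mul, signedRpow_mul,
      signedRpow_mul, hcq]
    simp only [signedRpow, mul_comm (‖x‖ ^ (-δ))]
  · exact Eventually.of_forall fun x => Real.rpow_nonneg (abs_nonneg _) _
  · have := hwm k
    exact Measurable.aestronglyMeasurable (by fun_prop)
end
end
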